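/- arXiv:1705.08617 — 3 statements merged into one kernel-verified Lean document; each statement's English description precedes it below -/
import Mathlib

section
/- Fix q > 2 and ε ∈ (0, 1). Let p_G be a probability measure on ℝ with p_G({0}) = 0, let G have law p_G with 0 < E|G|^{2q−2} < ∞, let B be a random variable with law p_B = (1 − ε)δ₀ + ε·p_G (δ₀ the point mass at 0), and let Z be a standard Gaussian random variable independent of B. Define R_q(α, τ) = E(η_q(B/τ + Z; α) − B/τ)² for α ≥ 0 and τ > 0. Suppose A : (0, ∞) → [0, ∞) is a function such that for each τ > 0, A(τ) minimizes α ↦ R_q(α, τ) over α ∈ [0, ∞). Then A(τ)/τ^q → (q−1)·E|G|^{q−2} / (q·E|G|^{2q−2}) as τ → 0⁺. -/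
open MeasureTheory ProbabilityTheory Filter

/-- The proximal operator `η_q(u; χ)`, i.e. the (unique, for `q ≥ 1`, `χ > 0`) global
minimizer over `z ∈ ℝ` of `z ↦ (1/2)(u − z)² + χ|z|^q`. -/
noncomputable def prox (q χ u : ℝ) : ℝ :=
  Classical.epsilon fun z : ℝ =>
    ∀ w : ℝ, (1 / 2) * (u - z) ^ 2 + χ * |z| ^ q ≤ (1 / 2) * (u - w) ^ 2 + χ * |w| ^ q

/-- The law `p_B = (1 − ε)·δ₀ + ε·p_G` of the signal coordinates. -/
noncomputable def mixLaw (ε : ℝ) (pG : Measure ℝ) : Measure ℝ :=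
  (ENNReal.ofReal (1 - ε)) • Measure.dirac (0 : ℝ) + (ENNReal.ofReal ε) • pG

/-- The risk `R_q(α, τ) = E (η_q(B/τ + Z; α) − B/τ)²`, with `B ∼ p_B` and `Z` standard
Gaussian independent of `B`. -/
noncomputable def riskR (q : ℝ) (pB : Measure ℝ) (α τ : ℝ) : ℝ :=
  ∫ b, ∫ z, (prox q α (b / τ + z) - b / τ) ^ 2 ∂(gaussianReal 0 1) ∂pB

/-- The odd power `x ↦ |x| ^ (q - 2) * x`, which is the derivative of `|x| ^ q / q`. -/
noncomputable def oddPow (q x : ℝ) : ℝ := |x| ^ (q - 2) * x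

section OddPow

variable {q : ℝ}

lemma continuous_oddPow (hq : 2 < q) : Continuous (oddPow q) := by
  unfold oddPow
  exact (continuous_abs.rpow_const fun x => Or.inr (by linarith)).mul continuous_id

lemma hasDerivAt_oddPow (hq : 2 < q) (x : ℝ) :
    HasDerivAt (oddPow q) ((q - 1) * |x| ^ (q - 2)) x := by
  refine hasDerivAt_of_hasDerivAt_of_ne' (x := 0) (g := fun x : ℝ => (q - 1) * |x| ^ (q - 2))
    (fun y hy => ?_) (continuous_oddPow hq).continuousAt ?_ x
  · have h := ((hasDerivAt_abs hy).rpow_const (p := q - 2)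
      (Or.inl (abs_ne_zero.2 hy))).mul (hasDerivAt_id y)
    refine h.congr_deriv ?_
    have h1 : |y| ^ (q - 2) = |y| ^ (q - 2 - 1) * |y| := by
      rw [← Real.rpow_add_one (abs_ne_zero.2 hy)]; ring_nf
    have h2 : (SignType.sign y : ℝ) * y = |y| := by
      rw [mul_comm]; exact self_mul_sign y
    simp only [id, mul_one]
    rw [h1, ← h2]; ring
  · exact ((continuous_abs.rpow_const fun x => Or.inr (by linarith)).const_mul _).continuousAt

lemma hasStrictDerivAt_oddPow (hq : 2 < q) (x : ℝ) :
    HasStrictDerivAt (oddPow q) ((q - 1) * |x| ^ (q - 2)) x :=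
  hasStrictDerivAt_of_hasDerivAt_of_continuousAt
    (Eventually.of_forall fun y => hasDerivAt_oddPow hq y)
    ((continuous_abs.rpow_const fun _ => Or.inr (by linarith)).const_mul _).continuousAt

lemma monotone_oddPow (hq : 2 < q) : Monotone (oddPow q) := by
  refine monotone_of_deriv_nonneg (fun x => (hasDerivAt_oddPow hq x).differentiableAt) fun x => ?_
  rw [(hasDerivAt_oddPow hq x).deriv]
  have : 0 < q - 1 := by linarith
  positivity

lemma oddPow_zero : oddPow q 0 = 0 := by simp [oddPow]

lemma oddPow_neg (x : ℝ) : oddPow q (-x) = -oddPow q x := by simp [oddPow]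

lemma oddPow_smul {t : ℝ} (ht : 0 < t) (x : ℝ) :
    oddPow q (t * x) = t ^ (q - 1) * oddPow q x := by
  have h : t ^ (q - 1) = t ^ (q - 2) * t := by
    rw [← Real.rpow_add_one ht.ne']; ring_nf
  rw [oddPow, abs_mul, Real.mul_rpow (abs_nonneg _) (abs_nonneg _), abs_of_pos ht, h, oddPow]
  ring

lemma abs_oddPow (hq : 2 < q) (x : ℝ) : |oddPow q x| = |x| ^ (q - 1) := by
  rw [oddPow, abs_mul, abs_of_nonneg (by positivity : 0 ≤ |x| ^ (q - 2)),
    ← Real.rpow_add_one' (abs_nonneg x) (by linarith)]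
  ring_nf

lemma oddPow_sq (hq : 2 < q) (x : ℝ) : oddPow q x ^ 2 = |x| ^ (2 * q - 2) := by
  rw [← sq_abs, abs_oddPow hq, ← Real.rpow_mul_natCast (abs_nonneg x)]
  congr 1; push_cast; ring

lemma self_mul_oddPow (hq : 2 < q) (x : ℝ) : x * oddPow q x = |x| ^ q := by
  rw [oddPow, mul_left_comm, ← abs_mul_abs_self x, ← mul_assoc,
    ← Real.rpow_add_one' (abs_nonneg x) (by linarith),
    ← Real.rpow_add_one' (abs_nonneg x) (by linarith)]
  ring_nf

lemma abs_oddPow_sub_le (hq : 2 < q) {x y M : ℝ} (hx : |x| ≤ M) (hy : |y| ≤ M) :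
    |oddPow q y - oddPow q x| ≤ (q - 1) * M ^ (q - 2) * |y - x| := by
  refine Convex.norm_image_sub_le_of_norm_hasDerivWithin_le (s := Set.Icc (-M) M)
    (fun z _ => (hasDerivAt_oddPow hq z).hasDerivWithinAt) (fun z hz => ?_) (convex_Icc _ _)
    (abs_le.1 hx) (abs_le.1 hy)
  have h1 : 0 < q - 1 := by linarith
  rw [Real.norm_of_nonneg (by positivity)]
  have h2 : |z| ≤ M := abs_le.2 hz
  have h3 : 0 ≤ q - 2 := by linarith
  gcongr

lemma abs_rpow_tangent (hq : 2 < q) (z w : ℝ) :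
    |z| ^ q + q * oddPow q z * (w - z) ≤ |w| ^ q := by
  have hc : q.HolderConjugate (q / (q - 1)) :=
    Real.HolderConjugate.conjExponent (by linarith)
  have h := Real.young_inequality_of_nonneg (abs_nonneg w)
    (Real.rpow_nonneg (abs_nonneg z) (q - 1)) hc
  have h0 : q - 1 ≠ 0 := by linarith
  have hq0 : q ≠ 0 := by linarith
  rw [← Real.rpow_mul (abs_nonneg z), mul_div_cancel₀ _ h0] at h
  have h1 : oddPow q z * w ≤ |w| * |z| ^ (q - 1) := by
    rw [← abs_oddPow hq, mul_comm, ← abs_mul]; exact le_abs_self _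
  have h2 := self_mul_oddPow hq z
  have h3 : q * (|w| ^ q / q + |z| ^ q / (q / (q - 1))) = |w| ^ q + (q - 1) * |z| ^ q := by
    field_simp
  nlinarith [mul_le_mul_of_nonneg_left (h1.trans h) (by linarith : 0 ≤ q)]

end OddPow

section Prox

variable {q χ : ℝ}

lemma prox_eq_of_stationary (hq : 2 < q) (hχ : 0 ≤ χ) {u z : ℝ}
    (hz : z + χ * q * oddPow q z = u) : prox q χ u = z := by
  have key : ∀ w : ℝ, (1 / 2) * (u - z) ^ 2 + χ * |z| ^ q + (1 / 2) * (w - z) ^ 2 ≤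
      (1 / 2) * (u - w) ^ 2 + χ * |w| ^ q := fun w => by
    have := mul_le_mul_of_nonneg_left (abs_rpow_tangent hq z w) hχ
    subst hz
    nlinarith
  have hmin := Classical.epsilon_spec (p := fun z : ℝ =>
    ∀ w : ℝ, (1 / 2) * (u - z) ^ 2 + χ * |z| ^ q ≤ (1 / 2) * (u - w) ^ 2 + χ * |w| ^ q)
    ⟨z, fun w => by nlinarith [key w, sq_nonneg (w - z)]⟩
  change ∀ w : ℝ, (1 / 2) * (u - prox q χ u) ^ 2 + χ * |prox q χ u| ^ q ≤
    (1 / 2) * (u - w) ^ 2 + χ * |w| ^ q at hmin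
  have h : (prox q χ u - z) ^ 2 ≤ 0 := by linarith [hmin z, key (prox q χ u)]
  exact sub_eq_zero.1 (pow_eq_zero_iff two_ne_zero |>.1 (le_antisymm h (sq_nonneg _)))

lemma prox_stationary (hq : 2 < q) (hχ : 0 ≤ χ) (u : ℝ) :
    prox q χ u + χ * q * oddPow q (prox q χ u) = u := by
  have hq0 : 0 < q := by linarith
  have hpos : 0 ≤ χ * q * oddPow q |u| := by
    unfold oddPow; positivity
  have hcont : Continuous fun z => z + χ * q * oddPow q z :=
    continuous_id.add ((continuous_oddPow hq).const_mul _)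
  obtain ⟨z, -, hz⟩ := intermediate_value_Icc (a := -|u|) (b := |u|)
    (by linarith [abs_nonneg u]) hcont.continuousOn
    (⟨by rw [oddPow_neg]; linarith [neg_abs_le u], by linarith [le_abs_self u]⟩ :
      u ∈ Set.Icc (-|u| + χ * q * oddPow q (-|u|)) (|u| + χ * q * oddPow q |u|))
  rw [prox_eq_of_stationary hq hχ hz]
  exact hz

lemma prox_zero_right (hq : 2 < q) (hχ : 0 ≤ χ) : prox q χ 0 = 0 :=
  prox_eq_of_stationary hq hχ (by simp [oddPow_zero])

lemma monotone_prox (hq : 2 < q) (hχ : 0 ≤ χ) : Monotone (prox q χ) := by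
  intro u v huv
  by_contra! h
  have h1 := mul_le_mul_of_nonneg_left (monotone_oddPow hq h.le)
    (mul_nonneg hχ (by linarith : 0 ≤ q))
  linarith [prox_stationary hq hχ u, prox_stationary hq hχ v]

lemma monotone_sub_prox (hq : 2 < q) (hχ : 0 ≤ χ) :
    Monotone fun u => χ * q * oddPow q (prox q χ u) := fun _ _ huv =>
  mul_le_mul_of_nonneg_left (monotone_oddPow hq (monotone_prox hq hχ huv))
    (mul_nonneg hχ (by linarith))

lemma abs_prox_sub_le (hq : 2 < q) (hχ : 0 ≤ χ) (u v : ℝ) :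
    |prox q χ u - prox q χ v| ≤ |u - v| := by
  wlog huv : v ≤ u generalizing u v
  · rw [abs_sub_comm, abs_sub_comm u]; exact this v u (le_of_not_ge huv)
  have h1 := monotone_prox hq hχ huv
  have h2 := monotone_sub_prox hq hχ huv
  simp only at h2
  rw [abs_of_nonneg (by linarith), abs_of_nonneg (by linarith)]
  linarith [prox_stationary hq hχ u, prox_stationary hq hχ v]

lemma abs_oddPow_prox_sub_le (hq : 2 < q) (hχ : 0 ≤ χ) (u v : ℝ) :
    χ * q * |oddPow q (prox q χ u) - oddPow q (prox q χ v)| ≤ |u - v| := by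
  wlog huv : v ≤ u generalizing u v
  · rw [abs_sub_comm, abs_sub_comm u]; exact this v u (le_of_not_ge huv)
  have h1 := monotone_prox hq hχ huv
  rw [abs_of_nonneg (sub_nonneg.2 (monotone_oddPow hq h1)), abs_of_nonneg (by linarith)]
  linarith [prox_stationary hq hχ u, prox_stationary hq hχ v]

lemma abs_prox_le (hq : 2 < q) (hχ : 0 ≤ χ) (u : ℝ) : |prox q χ u| ≤ |u| := by
  simpa [prox_zero_right hq hχ] using abs_prox_sub_le hq hχ u 0

lemma continuous_prox (hq : 2 < q) (hχ : 0 ≤ χ) : Continuous (prox q χ) :=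
  (LipschitzWith.of_dist_le_mul (K := 1) fun u v => by
    simpa [Real.dist_eq] using abs_prox_sub_le hq hχ u v).continuous

lemma prox_neg (hq : 2 < q) (hχ : 0 ≤ χ) (u : ℝ) : prox q χ (-u) = -prox q χ u :=
  prox_eq_of_stationary hq hχ (by rw [oddPow_neg]; linarith [prox_stationary hq hχ u])

/-- Increasing the penalty increases the displacement `u - prox q χ u`. -/
lemma sq_penalty_mono (hq : 2 < q) {μ : ℝ} (hμ : 0 ≤ μ) (hμχ : μ ≤ χ) (u : ℝ) :
    (μ * oddPow q (prox q μ u)) ^ 2 ≤ (χ * oddPow q (prox q χ u)) ^ 2 := by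
  have hχ := hμ.trans hμχ
  wlog hu : 0 ≤ u generalizing u
  · have := this (-u) (by linarith)
    simpa [prox_neg hq hμ, prox_neg hq hχ, oddPow_neg] using this
  have hx : 0 ≤ prox q χ u := by
    simpa [prox_zero_right hq hχ] using monotone_prox hq hχ hu
  have hy : 0 ≤ prox q μ u := by
    simpa [prox_zero_right hq hμ] using monotone_prox hq hμ hu
  have hfx : 0 ≤ oddPow q (prox q χ u) := by
    simpa [oddPow_zero] using monotone_oddPow hq hx
  have hfy : 0 ≤ oddPow q (prox q μ u) := by
    simpa [oddPow_zero] using monotone_oddPow hq hy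
  have e1 := prox_stationary hq hχ u
  have e2 := prox_stationary hq hμ u
  have hq0 : 0 < q := by linarith
  have hle : prox q χ u ≤ prox q μ u := by
    by_contra! h
    have := mul_le_mul (mul_le_mul_of_nonneg_right hμχ hq0.le) (monotone_oddPow hq h.le) hfy
      (by positivity)
    linarith
  have : μ * oddPow q (prox q μ u) ≤ χ * oddPow q (prox q χ u) := by
    refine le_of_mul_le_mul_left ?_ hq0
    linarith
  gcongr

lemma prox_scaling (hq : 2 < q) {τ : ℝ} (hτ : 0 < τ) {c : ℝ} (hc : 0 ≤ c) (b z : ℝ) :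
    prox q (c * τ ^ q) (b / τ + z) = τ⁻¹ * prox q (c * τ ^ 2) (b + τ * z) := by
  refine prox_eq_of_stationary hq (by positivity) ?_
  have e := prox_stationary hq (by positivity : 0 ≤ c * τ ^ 2) (b + τ * z)
  have h : τ ^ q * τ⁻¹ ^ (q - 1) = τ := by
    rw [Real.inv_rpow hτ.le, ← Real.rpow_neg hτ.le, ← Real.rpow_add hτ]
    simp
  rw [oddPow_smul (inv_pos.2 hτ)]
  calc _ = τ⁻¹ * prox q (c * τ ^ 2) (b + τ * z) + c * (τ ^ q * τ⁻¹ ^ (q - 1)) * q *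
        oddPow q (prox q (c * τ ^ 2) (b + τ * z)) := by ring
    _ = τ⁻¹ * (prox q (c * τ ^ 2) (b + τ * z) + c * τ ^ 2 * q *
        oddPow q (prox q (c * τ ^ 2) (b + τ * z))) := by rw [h]; field_simp
    _ = b / τ + z := by rw [e]; field_simp

end Prox

section Risk

variable {q χ : ℝ}

lemma abs_add_mul_le {τ : ℝ} (hτ : 0 < τ) (hτ1 : τ ≤ 1) (b z : ℝ) :
    |b + τ * z| ≤ 1 + |b| + |z| := by
  have h1 : |τ * z| ≤ |z| := by
    rw [abs_mul, abs_of_pos hτ]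
    exact mul_le_of_le_one_left (abs_nonneg z) hτ1
  linarith [abs_add_le b (τ * z)]

lemma abs_oddPow_prox_sq_le (hq : 2 < q) (hχ : 0 ≤ χ) {τ : ℝ} (hτ : 0 < τ) (hτ1 : τ ≤ 1)
    (b z : ℝ) :
    |oddPow q (prox q χ (b + τ * z)) ^ 2| ≤ (1 + |b| + |z|) ^ (2 * q - 2) := by
  rw [oddPow_sq hq, abs_of_nonneg (by positivity)]
  exact Real.rpow_le_rpow (abs_nonneg _)
    ((abs_prox_le hq hχ _).trans (abs_add_mul_le hτ hτ1 b z)) (by linarith)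

lemma abs_mul_oddPow_prox_le (hq : 2 < q) (hχ : 0 ≤ χ) (b z : ℝ) :
    |z * oddPow q (prox q χ b)| ≤ (1 + |b| + |z|) ^ (2 * q - 2) := by
  have hb := abs_nonneg b
  have hz := abs_nonneg z
  have hM : 1 ≤ 1 + |b| + |z| := by linarith
  rw [abs_mul, abs_oddPow hq]
  calc |z| * |prox q χ b| ^ (q - 1) ≤ (1 + |b| + |z|) * (1 + |b| + |z|) ^ (q - 1) := by
        gcongr
        · linarith
        · linarith
        · linarith [abs_prox_le hq hχ b]
    _ = (1 + |b| + |z|) ^ q := by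
        rw [mul_comm, ← Real.rpow_add_one (by linarith)]; ring_nf
    _ ≤ _ := Real.rpow_le_rpow_of_exponent_le hM (by linarith)

lemma abs_mul_oddPow_prox_sub_div_le (hq : 2 < q) (hχ : 0 ≤ χ) {τ : ℝ} (hτ : 0 < τ)
    (hτ1 : τ ≤ 1) (b z : ℝ) :
    |z * (oddPow q (prox q χ (b + τ * z)) - oddPow q (prox q χ b)) / τ| ≤
      (q - 1) * (1 + |b| + |z|) ^ (2 * q - 2) := by
  have hb := abs_nonneg b
  have hz := abs_nonneg z
  set M := 1 + |b| + |z| with hM_def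
  have hM : 1 ≤ M := by linarith
  have hq1 : 0 ≤ q - 1 := by linarith
  have h1 := abs_oddPow_sub_le hq (x := prox q χ b) (y := prox q χ (b + τ * z)) (M := M)
    ((abs_prox_le hq hχ b).trans (by linarith))
    ((abs_prox_le hq hχ _).trans (abs_add_mul_le hτ hτ1 b z))
  have h2 : |prox q χ (b + τ * z) - prox q χ b| ≤ τ * |z| := by
    have := abs_prox_sub_le hq hχ (b + τ * z) b
    rwa [add_sub_cancel_left, abs_mul, abs_of_pos hτ] at this
  rw [abs_div, abs_mul, abs_of_pos hτ, div_le_iff₀ hτ]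
  calc _ ≤ M * ((q - 1) * M ^ (q - 2) * (τ * M)) := by
        refine mul_le_mul (by linarith) (h1.trans ?_) (abs_nonneg _) (by linarith)
        have : τ * |z| ≤ τ * M := by gcongr; linarith
        have : 0 ≤ (q - 1) * M ^ (q - 2) := by positivity
        gcongr
        linarith
    _ = (q - 1) * M ^ q * τ := by
        have : M ^ q = M ^ (q - 2) * M ^ 2 := by
          rw [← Real.rpow_add_natCast (by linarith)]; norm_num
        rw [this]; ring
    _ ≤ _ := by
        gcongr
        linarith

lemma mul_oddPow_prox_sub_div_le_sq (hq : 2 < q) (hχ : 0 ≤ χ) {τ : ℝ} (hτ : 0 < τ) (b z : ℝ) :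
    χ * q * (z * (oddPow q (prox q χ (b + τ * z)) - oddPow q (prox q χ b)) / τ) ≤ z ^ 2 := by
  have h := abs_oddPow_prox_sub_le hq hχ (b + τ * z) b
  rw [add_sub_cancel_left, abs_mul, abs_of_pos hτ] at h
  have hχq : 0 ≤ χ * q := mul_nonneg hχ (by linarith)
  set d := oddPow q (prox q χ (b + τ * z)) - oddPow q (prox q χ b)
  rw [← mul_div_assoc, div_le_iff₀ hτ]
  calc χ * q * (z * d) ≤ χ * q * (|z| * |d|) := by
        refine mul_le_mul_of_nonneg_left ?_ hχq
        rw [← abs_mul]; exact le_abs_self _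
    _ = |z| * (χ * q * |d|) := by ring
    _ ≤ |z| * (τ * |z|) := by gcongr
    _ = z ^ 2 * τ := by rw [← sq_abs z]; ring

lemma tendsto_prox {l : Filter ℝ} (hq : 2 < q) {χ u : ℝ → ℝ} {b : ℝ} (hχ : ∀ τ, 0 ≤ χ τ)
    (hχ0 : Tendsto χ l (nhds 0)) (hu : Tendsto u l (nhds b)) :
    Tendsto (fun τ => prox q (χ τ) (u τ)) l (nhds b) := by
  have h1 : Tendsto (fun τ => χ τ * q * |u τ| ^ (q - 1)) l (nhds 0) := by
    simpa using (hχ0.mul_const q).mul (hu.abs.rpow_const (Or.inr (by linarith : 0 ≤ q - 1)))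
  have h2 : Tendsto (fun τ => prox q (χ τ) (u τ) - u τ) l (nhds 0) := by
    refine squeeze_zero_norm (fun τ => ?_) h1
    have e := prox_stationary hq (hχ τ) (u τ)
    have hq0 : 0 < q := by linarith
    have : prox q (χ τ) (u τ) - u τ = -(χ τ * q * oddPow q (prox q (χ τ) (u τ))) := by linarith
    rw [this, norm_neg, Real.norm_eq_abs, abs_mul, abs_of_nonneg (mul_nonneg (hχ τ) hq0.le),
      abs_oddPow hq]
    have := hχ τ
    have hq1 : 0 ≤ q - 1 := by linarith
    exact mul_le_mul_of_nonneg_left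
      (Real.rpow_le_rpow (abs_nonneg _) (abs_prox_le hq (hχ τ) _) hq1) (by positivity)
  simpa using h2.add hu

lemma tendsto_oddPow_prox_sub_div (hq : 2 < q) {χ : ℝ → ℝ} (hχ : ∀ τ, 0 ≤ χ τ)
    (hχ0 : Tendsto χ (nhdsWithin 0 (Set.Ioi 0)) (nhds 0)) (b z : ℝ) :
    Tendsto (fun τ => z * (oddPow q (prox q (χ τ) (b + τ * z)) - oddPow q (prox q (χ τ) b)) / τ)
      (nhdsWithin 0 (Set.Ioi 0)) (nhds (z * ((q - 1) * |b| ^ (q - 2) * z))) := by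
  set l := nhdsWithin (0 : ℝ) (Set.Ioi 0)
  have hid : Tendsto (fun τ : ℝ => τ) l (nhds 0) := tendsto_nhdsWithin_of_tendsto_nhds tendsto_id
  have hpos : ∀ᶠ τ in l, 0 < τ := eventually_mem_nhdsWithin
  have hu : Tendsto (fun τ => b + τ * z) l (nhds b) := by
    simpa using (hid.mul_const z).const_add b
  have hP := tendsto_prox hq hχ hχ0 hu
  have hP0 := tendsto_prox hq hχ hχ0 (tendsto_const_nhds (x := b))
  set x := fun τ => prox q (χ τ) (b + τ * z)
  set y := fun τ => prox q (χ τ) b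
  have hxy : ∀ τ, x τ - y τ = τ * z - χ τ * q * (oddPow q (x τ) - oddPow q (y τ)) := fun τ => by
    linarith [prox_stationary hq (hχ τ) (b + τ * z), prox_stationary hq (hχ τ) b]
  have hlip : ∀ τ, 0 < τ → |x τ - y τ| ≤ τ * |z| := fun τ hτ => by
    have := abs_prox_sub_le hq (hχ τ) (b + τ * z) b
    rwa [add_sub_cancel_left, abs_mul, abs_of_pos hτ] at this
  have hO : (fun τ => x τ - y τ) =O[l] fun τ => τ := by
    refine Asymptotics.IsBigO.of_bound |z| (hpos.mono fun τ hτ => ?_)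
    rw [Real.norm_eq_abs, Real.norm_eq_abs, abs_of_pos hτ, mul_comm]
    exact hlip τ hτ
  have hstrict := ((hasStrictDerivAt_oddPow hq b).isLittleO.comp_tendsto
    (hP.prodMk_nhds hP0)).trans_isBigO hO
  have hr := hstrict.tendsto_div_nhds_zero
  simp only [Function.comp_def, ContinuousLinearMap.toSpanSingleton_apply, smul_eq_mul] at hr
  set k := (q - 1) * |b| ^ (q - 2)
  have hOd : (fun τ => oddPow q (x τ) - oddPow q (y τ)) =O[l] fun τ => τ := by
    have h := ((hasStrictDerivAt_oddPow hq b).hasStrictFDerivAt.isBigO_sub.comp_tendsto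
      (hP.prodMk_nhds hP0)).trans hO
    exact h
  have hdiff : Tendsto (fun τ => (x τ - y τ) / τ) l (nhds z) := by
    have h : (fun τ => χ τ * q * (oddPow q (x τ) - oddPow q (y τ))) =o[l] fun τ => τ := by
      have h1 : (fun τ => χ τ * q) =o[l] fun _ => (1 : ℝ) := by
        rw [Asymptotics.isLittleO_one_iff]; simpa using hχ0.mul_const q
      simpa using h1.mul_isBigO hOd
    have h2 := (tendsto_const_nhds (x := z)).sub h.tendsto_div_nhds_zero
    rw [sub_zero] at h2
    refine h2.congr' (hpos.mono fun τ hτ => ?_)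
    simp only [hxy]
    field_simp
  have := ((hr.add (hdiff.mul_const k)).const_mul z)
  rw [zero_add, mul_comm z k] at this
  refine this.congr' (hpos.mono fun τ hτ => ?_)
  change _ = z * (oddPow q (x τ) - oddPow q (y τ)) / τ
  ring

variable {μ : Measure ℝ} [IsProbabilityMeasure μ]

lemma integrable_one_add_abs_rpow (hq : 2 < q)
    (hμ : Integrable (fun x => |x| ^ (2 * q - 2)) μ) :
    Integrable (fun p : ℝ × ℝ => (1 + |p.1| + |p.2|) ^ (2 * q - 2))
      (μ.prod (gaussianReal 0 1)) := by
  have hp : 0 < 2 * q - 2 := by linarith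
  set r := ENNReal.ofReal (2 * q - 2)
  have hr0 : r ≠ 0 := (ENNReal.ofReal_pos.2 hp).ne'
  have hrt : r ≠ ⊤ := ENNReal.ofReal_ne_top
  have hrr : r.toReal = 2 * q - 2 := ENNReal.toReal_ofReal hp.le
  have h1 : MemLp (fun x : ℝ => x) r μ := by
    rw [← integrable_norm_rpow_iff (by fun_prop) hr0 hrt, hrr]
    exact hμ
  have h2 : MemLp (fun x : ℝ => x) r (gaussianReal 0 1) := memLp_id_gaussianReal' r hrt
  have h := (((memLp_const (1 : ℝ)).add (h1.comp_fst (gaussianReal 0 1)).abs).add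
    (h2.comp_snd μ).abs).integrable_norm_rpow hr0 hrt
  rw [hrr] at h
  refine h.congr (Eventually.of_forall fun p => ?_)
  simp only [Pi.add_apply, Pi.abs_apply, Real.norm_eq_abs]
  rw [abs_of_nonneg (by positivity)]

lemma integral_sq_gaussianReal : ∫ z, z ^ 2 ∂(gaussianReal 0 1) = 1 := by
  have h := variance_id_gaussianReal (μ := 0) (v := 1)
  rw [variance_of_integral_eq_zero (by fun_prop) (by simp)] at h
  simpa using h

/-- The second moment of the rescaled displacement of the proximal operator. -/
noncomputable def sqTerm (q : ℝ) (μ : Measure ℝ) (τ χ : ℝ) : ℝ :=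
  ∫ p : ℝ × ℝ, oddPow q (prox q χ (p.1 + τ * p.2)) ^ 2 ∂(μ.prod (gaussianReal 0 1))

/-- The rescaled correlation of the noise with the displacement of the proximal operator. -/
noncomputable def crossTerm (q : ℝ) (μ : Measure ℝ) (τ χ : ℝ) : ℝ :=
  ∫ p : ℝ × ℝ, p.2 * (oddPow q (prox q χ (p.1 + τ * p.2)) - oddPow q (prox q χ p.1)) / τ
    ∂(μ.prod (gaussianReal 0 1))

lemma continuous_oddPow_prox (hq : 2 < q) (hχ : 0 ≤ χ) {f : ℝ × ℝ → ℝ} (hf : Continuous f) :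
    Continuous fun p => oddPow q (prox q χ (f p)) :=
  (continuous_oddPow hq).comp ((continuous_prox hq hχ).comp hf)

lemma integrable_sqTerm (hq : 2 < q) (hμ : Integrable (fun x => |x| ^ (2 * q - 2)) μ)
    (hχ : 0 ≤ χ) {τ : ℝ} (hτ : 0 < τ) (hτ1 : τ ≤ 1) :
    Integrable (fun p : ℝ × ℝ => oddPow q (prox q χ (p.1 + τ * p.2)) ^ 2)
      (μ.prod (gaussianReal 0 1)) := by
  exact (integrable_one_add_abs_rpow hq hμ).mono'
    ((continuous_oddPow_prox hq hχ (by fun_prop)).pow 2).aestronglyMeasurable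
    (Eventually.of_forall fun p => abs_oddPow_prox_sq_le hq hχ hτ hτ1 p.1 p.2)

lemma integrable_crossTerm (hq : 2 < q) (hμ : Integrable (fun x => |x| ^ (2 * q - 2)) μ)
    (hχ : 0 ≤ χ) {τ : ℝ} (hτ : 0 < τ) (hτ1 : τ ≤ 1) :
    Integrable (fun p : ℝ × ℝ => p.2 * (oddPow q (prox q χ (p.1 + τ * p.2)) -
      oddPow q (prox q χ p.1)) / τ) (μ.prod (gaussianReal 0 1)) := by
  exact ((integrable_one_add_abs_rpow hq hμ).const_mul (q - 1)).mono'
    ((continuous_snd.mul ((continuous_oddPow_prox hq hχ (by fun_prop)).sub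
      (continuous_oddPow_prox hq hχ continuous_fst))).div_const τ).aestronglyMeasurable
    (Eventually.of_forall fun p => abs_mul_oddPow_prox_sub_div_le hq hχ hτ hτ1 p.1 p.2)

lemma integrable_snd_sq :
    Integrable (fun p : ℝ × ℝ => p.2 ^ 2) (μ.prod (gaussianReal 0 1)) :=
  ((memLp_id_gaussianReal' (μ := 0) (v := 1) 2 (by simp)).integrable_sq).comp_snd μ

lemma integral_snd_sq : ∫ p : ℝ × ℝ, p.2 ^ 2 ∂(μ.prod (gaussianReal 0 1)) = 1 := by
  have := integral_prod_mul (μ := μ) (ν := gaussianReal 0 1) (fun _ : ℝ => (1 : ℝ))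
    (fun z : ℝ => z ^ 2)
  simpa [integral_sq_gaussianReal] using this

lemma riskR_expansion (hq : 2 < q) (hμ : Integrable (fun x => |x| ^ (2 * q - 2)) μ)
    {c : ℝ} (hc : 0 ≤ c) {τ : ℝ} (hτ : 0 < τ) (hτ1 : τ ≤ 1) :
    riskR q μ (c * τ ^ q) τ = 1 + τ ^ 2 * ((c * q) ^ 2 * sqTerm q μ τ (c * τ ^ 2) -
      2 * (c * q) * crossTerm q μ τ (c * τ ^ 2)) := by
  have hχ : 0 ≤ c * τ ^ 2 := by positivity
  have i1 := integrable_sqTerm hq hμ hχ hτ hτ1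
  have i2 := integrable_crossTerm hq hμ hχ hτ hτ1
  have i3 : Integrable (fun p : ℝ × ℝ => p.2 * oddPow q (prox q (c * τ ^ 2) p.1))
      (μ.prod (gaussianReal 0 1)) :=
    (integrable_one_add_abs_rpow hq hμ).mono'
      (continuous_snd.mul
        (continuous_oddPow_prox hq hχ continuous_fst)).aestronglyMeasurable
      (Eventually.of_forall fun p => abs_mul_oddPow_prox_le hq hχ p.1 p.2)
  have e3 : ∫ p : ℝ × ℝ, p.2 * oddPow q (prox q (c * τ ^ 2) p.1)
      ∂(μ.prod (gaussianReal 0 1)) = 0 := by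
    have := integral_prod_mul (μ := μ) (ν := gaussianReal 0 1)
      (fun b => oddPow q (prox q (c * τ ^ 2) b)) (fun z : ℝ => z)
    simpa [mul_comm] using this
  have hpt : ∀ b z : ℝ, (prox q (c * τ ^ q) (b / τ + z) - b / τ) ^ 2 =
      z ^ 2 + τ ^ 2 * ((c * q) ^ 2 * oddPow q (prox q (c * τ ^ 2) (b + τ * z)) ^ 2 -
        2 * (c * q) * (z * (oddPow q (prox q (c * τ ^ 2) (b + τ * z)) -
          oddPow q (prox q (c * τ ^ 2) b)) / τ)) -
        2 * (c * q * τ) * (z * oddPow q (prox q (c * τ ^ 2) b)) := fun b z => by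
    have e := prox_stationary hq hχ (b + τ * z)
    have : prox q (c * τ ^ q) (b / τ + z) - b / τ =
        z - c * q * τ * oddPow q (prox q (c * τ ^ 2) (b + τ * z)) := by
      rw [prox_scaling hq hτ hc]
      generalize prox q (c * τ ^ 2) (b + τ * z) = x at e ⊢
      field_simp
      linarith
    rw [this]
    field_simp
    ring
  have i4 := (i1.const_mul ((c * q) ^ 2)).sub (i2.const_mul (2 * (c * q)))
  have i5 := (integrable_snd_sq (μ := μ)).add (i4.const_mul (τ ^ 2))
  have i6 := i5.sub (i3.const_mul (2 * (c * q * τ)))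
  have hprod := integral_prod _ i6
  rw [integral_sub' i5 (i3.const_mul _), integral_add' integrable_snd_sq (i4.const_mul _),
    integral_const_mul, integral_sub' (i1.const_mul _) (i2.const_mul _), integral_const_mul,
    integral_const_mul, integral_const_mul, e3, integral_snd_sq] at hprod
  simp only [riskR, hpt]
  simp only [Pi.sub_apply, Pi.add_apply] at hprod
  rw [← hprod, sqTerm, crossTerm]
  ring

lemma tendsto_sqTerm (hq : 2 < q) (hμ : Integrable (fun x => |x| ^ (2 * q - 2)) μ)
    {χ : ℝ → ℝ} (hχ : ∀ τ, 0 ≤ χ τ) (hχ0 : Tendsto χ (nhdsWithin 0 (Set.Ioi 0)) (nhds 0)) :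
    Tendsto (fun τ => sqTerm q μ τ (χ τ)) (nhdsWithin 0 (Set.Ioi 0))
      (nhds (∫ x, |x| ^ (2 * q - 2) ∂μ)) := by
  have hid : Tendsto (fun τ : ℝ => τ) (nhdsWithin 0 (Set.Ioi 0)) (nhds 0) :=
    tendsto_nhdsWithin_of_tendsto_nhds tendsto_id
  have hpos : ∀ᶠ τ : ℝ in nhdsWithin 0 (Set.Ioi 0), 0 < τ := eventually_mem_nhdsWithin
  have hle1 : ∀ᶠ τ : ℝ in nhdsWithin 0 (Set.Ioi 0), τ ≤ 1 :=
    hid.eventually (eventually_le_nhds one_pos)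
  have hlim : ∫ p : ℝ × ℝ, oddPow q p.1 ^ 2 ∂(μ.prod (gaussianReal 0 1)) =
      ∫ x, |x| ^ (2 * q - 2) ∂μ := by
    simp only [oddPow_sq hq]
    have := integral_prod_mul (μ := μ) (ν := gaussianReal 0 1)
      (fun b => |b| ^ (2 * q - 2)) (fun _ : ℝ => (1 : ℝ))
    simpa using this
  rw [← hlim]
  refine tendsto_integral_filter_of_dominated_convergence _ ?_ ?_
    (integrable_one_add_abs_rpow hq hμ) ?_
  · filter_upwards [hpos, hle1] with τ hτ hτ1
    exact (integrable_sqTerm hq hμ (hχ τ) hτ hτ1).aestronglyMeasurable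
  · filter_upwards [hpos, hle1] with τ hτ hτ1
    exact Eventually.of_forall fun p => abs_oddPow_prox_sq_le hq (hχ τ) hτ hτ1 p.1 p.2
  · refine Eventually.of_forall fun p => ?_
    have hu : Tendsto (fun τ => p.1 + τ * p.2) (nhdsWithin 0 (Set.Ioi 0)) (nhds p.1) := by
      simpa using (hid.mul_const p.2).const_add p.1
    exact (((continuous_oddPow hq).tendsto _).comp (tendsto_prox hq hχ hχ0 hu)).pow 2

lemma tendsto_crossTerm (hq : 2 < q) (hμ : Integrable (fun x => |x| ^ (2 * q - 2)) μ)
    {χ : ℝ → ℝ} (hχ : ∀ τ, 0 ≤ χ τ) (hχ0 : Tendsto χ (nhdsWithin 0 (Set.Ioi 0)) (nhds 0)) :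
    Tendsto (fun τ => crossTerm q μ τ (χ τ)) (nhdsWithin 0 (Set.Ioi 0))
      (nhds ((q - 1) * ∫ x, |x| ^ (q - 2) ∂μ)) := by
  have hid : Tendsto (fun τ : ℝ => τ) (nhdsWithin 0 (Set.Ioi 0)) (nhds 0) :=
    tendsto_nhdsWithin_of_tendsto_nhds tendsto_id
  have hpos : ∀ᶠ τ : ℝ in nhdsWithin 0 (Set.Ioi 0), 0 < τ := eventually_mem_nhdsWithin
  have hle1 : ∀ᶠ τ : ℝ in nhdsWithin 0 (Set.Ioi 0), τ ≤ 1 :=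
    hid.eventually (eventually_le_nhds one_pos)
  have hlim : ∫ p : ℝ × ℝ, p.2 * ((q - 1) * |p.1| ^ (q - 2) * p.2)
      ∂(μ.prod (gaussianReal 0 1)) = (q - 1) * ∫ x, |x| ^ (q - 2) ∂μ := by
    have h := integral_prod_mul (μ := μ) (ν := gaussianReal 0 1)
      (fun b => (q - 1) * |b| ^ (q - 2)) (fun z : ℝ => z ^ 2)
    rw [integral_sq_gaussianReal, integral_const_mul, mul_one] at h
    rw [← h]
    refine integral_congr_ae (Eventually.of_forall fun p => ?_)
    ring
  rw [← hlim]
  refine tendsto_integral_filter_of_dominated_convergence _ ?_ ?_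
    ((integrable_one_add_abs_rpow hq hμ).const_mul (q - 1)) ?_
  · filter_upwards [hpos, hle1] with τ hτ hτ1
    exact (integrable_crossTerm hq hμ (hχ τ) hτ hτ1).aestronglyMeasurable
  · filter_upwards [hpos, hle1] with τ hτ hτ1
    exact Eventually.of_forall fun p =>
      abs_mul_oddPow_prox_sub_div_le hq (hχ τ) hτ hτ1 p.1 p.2
  · exact Eventually.of_forall fun p => tendsto_oddPow_prox_sub_div hq hχ hχ0 p.1 p.2

lemma mul_crossTerm_le_one (hq : 2 < q) (hμ : Integrable (fun x => |x| ^ (2 * q - 2)) μ)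
    (hχ : 0 ≤ χ) {τ : ℝ} (hτ : 0 < τ) (hτ1 : τ ≤ 1) :
    χ * q * crossTerm q μ τ χ ≤ 1 := by
  rw [crossTerm, ← integral_const_mul, ← integral_snd_sq (μ := μ)]
  exact integral_mono ((integrable_crossTerm hq hμ hχ hτ hτ1).const_mul _) integrable_snd_sq
    fun p => mul_oddPow_prox_sub_div_le_sq hq hχ hτ p.1 p.2

lemma sq_mul_sqTerm_mono (hq : 2 < q) (hμ : Integrable (fun x => |x| ^ (2 * q - 2)) μ)
    {m : ℝ} (hm : 0 ≤ m) (hmχ : m ≤ χ) {τ : ℝ} (hτ : 0 < τ) (hτ1 : τ ≤ 1) :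
    m ^ 2 * sqTerm q μ τ m ≤ χ ^ 2 * sqTerm q μ τ χ := by
  rw [sqTerm, sqTerm, ← integral_const_mul, ← integral_const_mul]
  refine integral_mono ((integrable_sqTerm hq hμ hm hτ hτ1).const_mul _)
    ((integrable_sqTerm hq hμ (hm.trans hmχ) hτ hτ1).const_mul _) fun p => ?_
  simpa only [mul_pow] using sq_penalty_mono hq hm hmχ (p.1 + τ * p.2)

lemma tendsto_minimizer_div_rpow (hq : 2 < q)
    (hμ : Integrable (fun x => |x| ^ (2 * q - 2)) μ) (hpos : 0 < ∫ x, |x| ^ (2 * q - 2) ∂μ)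
    {A : ℝ → ℝ} (hA : ∀ τ : ℝ, 0 < τ → 0 ≤ A τ ∧
      ∀ α : ℝ, 0 ≤ α → riskR q μ (A τ) τ ≤ riskR q μ α τ) :
    Tendsto (fun τ => A τ / τ ^ q) (nhdsWithin 0 (Set.Ioi 0))
      (nhds ((q - 1) * (∫ x, |x| ^ (q - 2) ∂μ) / (q * ∫ x, |x| ^ (2 * q - 2) ∂μ))) := by
  have lim_sq := fun χ h h' => tendsto_sqTerm (χ := χ) hq hμ h h'
  have lim_cross := fun χ h h' => tendsto_crossTerm (χ := χ) hq hμ h h'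
  have hk : 0 ≤ (q - 1) * ∫ x, |x| ^ (q - 2) ∂μ :=
    mul_nonneg (by linarith) (integral_nonneg fun x => by positivity)
  set a := ∫ x, |x| ^ (2 * q - 2) ∂μ
  set k := (q - 1) * ∫ x, |x| ^ (q - 2) ∂μ
  have hq0 : 0 < q := by linarith
  have hid : Tendsto (fun τ : ℝ => τ) (nhdsWithin 0 (Set.Ioi 0)) (nhds 0) :=
    tendsto_nhdsWithin_of_tendsto_nhds tendsto_id
  have hτpos : ∀ᶠ τ : ℝ in nhdsWithin 0 (Set.Ioi 0), 0 < τ := eventually_mem_nhdsWithin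
  have hle1 : ∀ᶠ τ : ℝ in nhdsWithin 0 (Set.Ioi 0), τ ≤ 1 :=
    hid.eventually (eventually_le_nhds one_pos)
  set c : ℝ → ℝ := fun τ => max (A τ / τ ^ q) 0
  have hc0 : ∀ τ, 0 ≤ c τ := fun τ => le_max_right _ _
  have hcA : ∀ τ, 0 < τ → c τ = A τ / τ ^ q := fun τ hτ =>
    max_eq_left (div_nonneg (hA τ hτ).1 (Real.rpow_nonneg hτ.le q))
  have hopt : ∀ τ, 0 < τ → τ ≤ 1 → ∀ d, 0 ≤ d →
      (c τ * q) ^ 2 * sqTerm q μ τ (c τ * τ ^ 2) -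
        2 * (c τ * q) * crossTerm q μ τ (c τ * τ ^ 2) ≤
      (d * q) ^ 2 * sqTerm q μ τ (d * τ ^ 2) - 2 * (d * q) * crossTerm q μ τ (d * τ ^ 2) := by
    intro τ hτ hτ1 d hd
    have hτq : 0 < τ ^ q := Real.rpow_pos_of_pos hτ q
    have h := (hA τ hτ).2 (d * τ ^ q) (mul_nonneg hd hτq.le)
    have hAc : A τ = c τ * τ ^ q := by rw [hcA τ hτ, div_mul_cancel₀ _ hτq.ne']
    rw [hAc, riskR_expansion hq hμ (hc0 τ) hτ hτ1, riskR_expansion hq hμ hd hτ hτ1] at h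
    exact le_of_mul_le_mul_left (by linarith) (pow_pos hτ 2)
  set χ : ℝ → ℝ := fun τ => c τ * τ ^ 2 with hχ_def
  have hχ : ∀ τ, 0 ≤ χ τ := fun τ => mul_nonneg (hc0 τ) (sq_nonneg τ)
  have hsqrt : Tendsto (fun τ : ℝ => √τ) (nhdsWithin 0 (Set.Ioi 0)) (nhds 0) := by
    simpa using hid.sqrt
  have hχ0 : Tendsto χ (nhdsWithin 0 (Set.Ioi 0)) (nhds 0) := by
    have hm : ∀ τ, 0 ≤ min (χ τ) (√τ) := fun τ => le_min (hχ τ) (Real.sqrt_nonneg τ)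
    have hm0 : Tendsto (fun τ => min (χ τ) (√τ)) (nhdsWithin 0 (Set.Ioi 0)) (nhds 0) :=
      squeeze_zero hm (fun τ => min_le_right _ _) hsqrt
    have hlarge := (lim_sq _ hm hm0).eventually (eventually_gt_nhds (half_lt_self hpos))
    have hsmall : ∀ᶠ τ : ℝ in nhdsWithin 0 (Set.Ioi 0), τ < q ^ 2 * a / 4 :=
      hid.eventually (eventually_lt_nhds (by positivity))
    refine squeeze_zero' (Eventually.of_forall hχ) ?_ hsqrt
    filter_upwards [hτpos, hle1, hlarge, hsmall] with τ hτ hτ1 h1 h2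
    by_contra! hlt
    have hmτ : min (χ τ) (√τ) = √τ := min_eq_right hlt.le
    rw [hmτ] at h1
    have h3 := sq_mul_sqTerm_mono hq hμ (Real.sqrt_nonneg τ) hlt.le hτ hτ1
    rw [Real.sq_sqrt hτ.le] at h3
    have h4 := mul_crossTerm_le_one hq hμ (hχ τ) hτ hτ1
    have h5 := hopt τ hτ hτ1 0 le_rfl
    have h6 : q ^ 2 * (χ τ ^ 2 * sqTerm q μ τ (χ τ)) ≤ 2 * τ ^ 2 := by
      have e : q ^ 2 * (χ τ ^ 2 * sqTerm q μ τ (χ τ)) -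
          2 * τ ^ 2 * (χ τ * q * crossTerm q μ τ (χ τ)) = τ ^ 4 * ((c τ * q) ^ 2 *
            sqTerm q μ τ (χ τ) - 2 * (c τ * q) * crossTerm q μ τ (χ τ)) := by
        simp only [hχ_def]; ring
      have e' := mul_nonpos_of_nonneg_of_nonpos (pow_nonneg hτ.le 4)
        (h5.trans_eq (by ring))
      have e'' := mul_le_mul_of_nonneg_left h4 (by positivity : 0 ≤ 2 * τ ^ 2)
      linarith
    have h7 : q ^ 2 * (τ * (a / 2)) ≤ 2 * τ ^ 2 := by
      refine le_trans ?_ ((mul_le_mul_of_nonneg_left h3 (sq_nonneg q)).trans h6)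
      gcongr
    nlinarith
  have hI := lim_sq _ hχ hχ0
  have hJ := lim_cross _ hχ hχ0
  have hd : 0 ≤ k / (q * a) := by positivity
  have hd0 : Tendsto (fun τ : ℝ => k / (q * a) * τ ^ 2) (nhdsWithin 0 (Set.Ioi 0)) (nhds 0) := by
    simpa using (hid.pow 2).const_mul (k / (q * a))
  have hI' := lim_sq _ (fun τ => mul_nonneg hd (sq_nonneg τ)) hd0
  have hJ' := lim_cross _ (fun τ => mul_nonneg hd (sq_nonneg τ)) hd0
  have hbound := ((((hI'.const_mul ((k / (q * a) * q) ^ 2)).sub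
    (hJ'.const_mul (2 * (k / (q * a) * q)))).add ((hJ.pow 2).div hI hpos.ne')).div hI hpos.ne')
  have hlim0 : ((k / (q * a) * q) ^ 2 * a - 2 * (k / (q * a) * q) * k + k ^ 2 / a) / a = 0 := by
    field_simp
    ring
  rw [hlim0] at hbound
  have hsq : Tendsto (fun τ => (c τ * q - crossTerm q μ τ (χ τ) / sqTerm q μ τ (χ τ)) ^ 2)
      (nhdsWithin 0 (Set.Ioi 0)) (nhds 0) := by
    refine squeeze_zero' (Eventually.of_forall fun τ => sq_nonneg _) ?_ hbound
    filter_upwards [hτpos, hle1, hI.eventually (eventually_gt_nhds hpos)] with τ hτ hτ1 hIpos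
    have h := hopt τ hτ hτ1 _ hd
    simp only [Pi.div_apply]
    rw [le_div_iff₀ hIpos]
    have e : (c τ * q - crossTerm q μ τ (χ τ) / sqTerm q μ τ (χ τ)) ^ 2 * sqTerm q μ τ (χ τ) =
        (c τ * q) ^ 2 * sqTerm q μ τ (χ τ) - 2 * (c τ * q) * crossTerm q μ τ (χ τ) +
          crossTerm q μ τ (χ τ) ^ 2 / sqTerm q μ τ (χ τ) := by
      field_simp
      ring
    rw [e]
    gcongr ?_ + _
  have habs := hsq.sqrt
  simp only [Real.sqrt_sq_eq_abs, Real.sqrt_zero] at habs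
  have hfin := (((tendsto_zero_iff_abs_tendsto_zero _).2 habs).add
    (hJ.div hI hpos.ne')).div_const q
  rw [zero_add, div_div, mul_comm a q] at hfin
  refine hfin.congr' (hτpos.mono fun τ hτ => ?_)
  simp only [Pi.div_apply, sub_add_cancel]
  rw [← hcA τ hτ]
  field_simp

end Risk

section MixLaw

variable {ε : ℝ} {pG : Measure ℝ}

lemma isProbabilityMeasure_mixLaw [IsProbabilityMeasure pG] (hε : ε ∈ Set.Ioo (0 : ℝ) 1) :
    IsProbabilityMeasure (mixLaw ε pG) := by
  refine ⟨?_⟩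
  simp only [mixLaw, Measure.add_apply, Measure.smul_apply, measure_univ, smul_eq_mul, mul_one]
  rw [← ENNReal.ofReal_add (by linarith [hε.2]) hε.1.le]
  simp

lemma integrable_mixLaw {f : ℝ → ℝ} (hf : Integrable f pG) : Integrable f (mixLaw ε pG) :=
  ((integrable_dirac (by simp)).smul_measure ENNReal.ofReal_ne_top).add_measure
    (hf.smul_measure ENNReal.ofReal_ne_top)

lemma integral_mixLaw (hε : 0 ≤ ε) {f : ℝ → ℝ} (hf : Integrable f pG) (hf0 : f 0 = 0) :
    ∫ x, f x ∂(mixLaw ε pG) = ε * ∫ x, f x ∂pG := by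
  rw [mixLaw, integral_add_measure
    ((integrable_dirac (by simp)).smul_measure ENNReal.ofReal_ne_top)
    (hf.smul_measure ENNReal.ofReal_ne_top), integral_smul_measure, integral_smul_measure,
    integral_dirac, hf0, ENNReal.toReal_ofReal hε]
  simp

end MixLaw


/-- For `q > 2`, `ε ∈ (0,1)`, `p_G` with no atom at `0` and
`0 < E|G|^{2q−2} < ∞`, if `A(τ)` minimizes `α ↦ R_q(α, τ)` over `α ∈ [0, ∞)` for each
`τ > 0`, then `A(τ)/τ^q → (q−1)·E|G|^{q−2} / (q·E|G|^{2q−2})` as `τ → 0⁺`. -/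
theorem stmt_4 (q ε : ℝ) (hq : 2 < q) (hε : ε ∈ Set.Ioo (0 : ℝ) 1)
    (pG : Measure ℝ) [IsProbabilityMeasure pG] (hG0 : pG {0} = 0)
    (hInt : Integrable (fun x => |x| ^ (2 * q - 2)) pG)
    (hpos : 0 < ∫ x, |x| ^ (2 * q - 2) ∂pG)
    (A : ℝ → ℝ)
    (hA : ∀ τ : ℝ, 0 < τ → 0 ≤ A τ ∧
      ∀ α : ℝ, 0 ≤ α → riskR q (mixLaw ε pG) (A τ) τ ≤ riskR q (mixLaw ε pG) α τ) :
    Tendsto (fun τ => A τ / τ ^ q) (nhdsWithin 0 (Set.Ioi 0))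
      (nhds ((q - 1) * (∫ x, |x| ^ (q - 2) ∂pG) / (q * ∫ x, |x| ^ (2 * q - 2) ∂pG))) := by
  have hprob := isProbabilityMeasure_mixLaw (pG := pG) hε
  have hInt' : Integrable (fun x => |x| ^ (q - 2)) pG := by
    simpa using integrable_norm_rpow_of_le (f := fun x : ℝ => x) (by fun_prop)
      (by linarith : 0 ≤ q - 2) (by linarith : 0 ≤ 2 * q - 2) (by linarith) hInt
  have e1 := integral_mixLaw hε.1.le hInt (by simp [Real.zero_rpow (by linarith : 2 * q - 2 ≠ 0)])
  have e2 := integral_mixLaw hε.1.le hInt' (by simp [Real.zero_rpow (by linarith : q - 2 ≠ 0)])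
  have h := tendsto_minimizer_div_rpow hq (integrable_mixLaw (ε := ε) hInt)
    (by rw [e1]; exact mul_pos hε.1 hpos) hA
  rw [e1, e2] at h
  convert h using 2
  have := hε.1.ne'
  field_simp
end

section
/- Let q > 1. Then lim_{α → ∞} α^{2/(q−1)} · ∫_ℝ η_q(z; α)² φ(z) dz = q^{−2/(q−1)} · ∫_ℝ |z|^{2/(q−1)} φ(z) dz, i.e., α^{2/(q−1)}·E[η_q(Z; α)²] converges to q^{−2/(q−1)}·E|Z|^{2/(q−1)} as α → ∞. -/
open MeasureTheory ProbabilityTheory Filter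

theorem prox_spec {q χ : ℝ} (hq : 1 < q) (hχ : 0 < χ) (u w : ℝ) :
    (1 / 2) * (u - prox q χ u) ^ 2 + χ * |prox q χ u| ^ q
      ≤ (1 / 2) * (u - w) ^ 2 + χ * |w| ^ q := by
  refine Classical.epsilon_spec (p := fun z : ℝ =>
    ∀ w : ℝ, (1 / 2) * (u - z) ^ 2 + χ * |z| ^ q ≤ (1 / 2) * (u - w) ^ 2 + χ * |w| ^ q) ?_ w
  have hc : Continuous fun z : ℝ => (1 / 2) * (u - z) ^ 2 + χ * |z| ^ q :=
    (by fun_prop : Continuous fun z : ℝ => (1 / 2) * (u - z) ^ 2).add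
      (continuous_const.mul (continuous_abs.rpow_const fun _ => Or.inr (by linarith)))
  refine hc.exists_forall_le' 0 ?_
  filter_upwards [(tendsto_norm_cocompact_atTop (E := ℝ)).eventually_ge_atTop (2 * |u|)]
    with z hz
  rw [Real.norm_eq_abs] at hz
  have h0 : (0 : ℝ) ≤ χ * |z| ^ q := by positivity
  have h1 : |u| ≤ |u - z| := by
    have := abs_sub_abs_le_abs_sub z u
    rw [abs_sub_comm] at this
    linarith
  have h2 := sq_le_sq.mpr h1
  rw [abs_zero, Real.zero_rpow (by linarith), sub_zero]
  linarith

/-- The stationarity equation of the proximal operator, in absolute values. -/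
theorem abs_prox_add {q χ : ℝ} (hq : 1 < q) (hχ : 0 < χ) (u : ℝ) :
    |prox q χ u| + χ * q * |prox q χ u| ^ (q - 1) = |u| := by
  set p := prox q χ u with hp
  have hd : HasDerivAt (fun z : ℝ => (1 / 2) * (u - z) ^ 2 + χ * |z| ^ q)
      (p - u + χ * (q * |p| ^ (q - 2) * p)) p := by
    have h1 := ((((hasDerivAt_id p).const_sub u).pow 2).const_mul (1 / 2 : ℝ)).add
      ((hasDerivAt_abs_rpow p hq).const_mul χ)
    refine h1.congr_deriv ?_
    simp
  have hmin : IsLocalMin (fun z : ℝ => (1 / 2) * (u - z) ^ 2 + χ * |z| ^ q) p :=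
    Eventually.of_forall fun w => prox_spec hq hχ u w
  have h0 := hmin.hasDerivAt_eq_zero hd
  have hu : u = p * (1 + χ * q * |p| ^ (q - 2)) := by linarith
  rcases eq_or_ne p 0 with h | h
  · rw [hu, h, abs_zero, Real.zero_rpow (by linarith)]
    simp
  · have hpos : 0 < |p| := abs_pos.mpr h
    have hnn : 0 ≤ 1 + χ * q * |p| ^ (q - 2) := by positivity
    have hsplit : |p| ^ (q - 1) = |p| ^ (q - 2) * |p| := by
      rw [← Real.rpow_add_one hpos.ne']
      congr 1
      ring
    rw [hsplit]
    conv_rhs => rw [hu, abs_mul, abs_of_nonneg hnn]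
    ring

theorem abs_prox_le_abs_prox {q χ : ℝ} (hq : 1 < q) (hχ : 0 < χ) {u v : ℝ} (h : |u| ≤ |v|) :
    |prox q χ u| ≤ |prox q χ v| := by
  by_contra! hlt
  have h1 : |prox q χ v| ^ (q - 1) ≤ |prox q χ u| ^ (q - 1) :=
    Real.rpow_le_rpow (abs_nonneg _) hlt.le (by linarith)
  have h2 := mul_le_mul_of_nonneg_left h1 (by positivity : 0 ≤ χ * q)
  linarith [abs_prox_add hq hχ u, abs_prox_add hq hχ v]

theorem measurable_abs_prox {q χ : ℝ} (hq : 1 < q) (hχ : 0 < χ) :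
    Measurable fun u => |prox q χ u| := by
  have hm : Monotone fun t : ℝ => |prox q χ (max 0 t)| := fun s t hst =>
    abs_prox_le_abs_prox hq hχ <| by
      rw [abs_of_nonneg (le_max_left _ _), abs_of_nonneg (le_max_left _ _)]
      exact max_le_max_left 0 hst
  have he : (fun u => |prox q χ u|) = (fun t : ℝ => |prox q χ (max 0 t)|) ∘ fun u => |u| := by
    funext u
    simp only [Function.comp, max_eq_right (abs_nonneg u)]
    exact le_antisymm (abs_prox_le_abs_prox hq hχ (by simp))
      (abs_prox_le_abs_prox hq hχ (by simp))
  rw [he]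
  exact hm.measurable.comp measurable_id.abs

theorem mul_abs_prox_rpow {q χ : ℝ} (hq : 1 < q) (hχ : 0 < χ) (u : ℝ) :
    χ * |prox q χ u| ^ (q - 1) = (|u| - |prox q χ u|) / q := by
  rw [eq_div_iff (by linarith)]
  linarith [abs_prox_add hq hχ u]

theorem rpow_mul_prox_sq {q χ : ℝ} (hq : 1 < q) (hχ : 0 < χ) (u : ℝ) :
    χ ^ (2 / (q - 1)) * prox q χ u ^ 2 = ((|u| - |prox q χ u|) / q) ^ (2 / (q - 1)) := by
  have hs : q - 1 ≠ 0 := by linarith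
  rw [← mul_abs_prox_rpow hq hχ, Real.mul_rpow hχ.le (by positivity),
    ← Real.rpow_mul (abs_nonneg _), mul_div_cancel₀ _ hs, Real.rpow_two, sq_abs]

theorem tendsto_abs_prox_atTop {q : ℝ} (hq : 1 < q) (u : ℝ) :
    Tendsto (fun χ => |prox q χ u|) atTop (nhds 0) := by
  have hs : 0 < q - 1 := by linarith
  have h1 : Tendsto (fun χ : ℝ => (|u| / q / χ) ^ (q - 1)⁻¹) atTop (nhds 0) := by
    have h := (tendsto_const_nhds (x := |u| / q)).div_atTop tendsto_id
      |>.rpow_const (p := (q - 1)⁻¹) (Or.inr (by positivity))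
    rwa [Real.zero_rpow (by positivity)] at h
  refine tendsto_of_tendsto_of_tendsto_of_le_of_le' tendsto_const_nhds h1
    (Eventually.of_forall fun _ => abs_nonneg _) ?_
  filter_upwards [eventually_gt_atTop 0] with χ hχ
  rw [Real.le_rpow_inv_iff_of_pos (abs_nonneg _) (by positivity) hs, le_div_iff₀ hχ, mul_comm,
    mul_abs_prox_rpow hq hχ]
  gcongr
  linarith [abs_nonneg (prox q χ u)]

theorem integrable_abs_rpow_gaussianReal {r : ℝ} (hr : 0 < r) :
    Integrable (fun z : ℝ => |z| ^ r) (gaussianReal 0 1) := by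
  have h := (memLp_id_gaussianReal (μ := 0) (v := 1) ⟨r, hr.le⟩).integrable_norm_rpow'
  exact h

/-- For `q > 1`,
`α^{2/(q−1)}·E[η_q(Z; α)²] → q^{−2/(q−1)}·E|Z|^{2/(q−1)}` as `α → ∞`, where `Z` is a
standard Gaussian random variable. -/
theorem stmt_8 (q : ℝ) (hq : 1 < q) :
    Tendsto
      (fun α : ℝ => α ^ (2 / (q - 1)) * ∫ z, (prox q α z) ^ 2 ∂(gaussianReal 0 1))
      atTop
      (nhds (q ^ (-(2 / (q - 1))) * ∫ z, |z| ^ (2 / (q - 1)) ∂(gaussianReal 0 1))) := by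
  have hr : 0 < 2 / (q - 1) := div_pos two_pos (by linarith)
  have hq0 : 0 < q := by linarith
  have hlim : ∀ z : ℝ, (|z| / q) ^ (2 / (q - 1)) = q ^ (-(2 / (q - 1))) * |z| ^ (2 / (q - 1)) := by
    intro z
    rw [Real.div_rpow (abs_nonneg _) hq0.le, Real.rpow_neg hq0.le]
    ring
  simp_rw [← integral_const_mul, ← hlim]
  refine tendsto_integral_filter_of_dominated_convergence
    (fun z => (|z| / q) ^ (2 / (q - 1))) ?_ ?_ ?_ ?_
  · filter_upwards [eventually_gt_atTop 0] with α hα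
    simp_rw [← sq_abs (prox q α _)]
    exact (((measurable_abs_prox hq hα).pow_const 2).const_mul _).aestronglyMeasurable
  · filter_upwards [eventually_gt_atTop 0] with α hα
    refine Eventually.of_forall fun z => ?_
    rw [Real.norm_of_nonneg (by positivity), rpow_mul_prox_sq hq hα]
    have h0 : 0 ≤ (|z| - |prox q α z|) / q := by
      rw [← mul_abs_prox_rpow hq hα]
      positivity
    refine Real.rpow_le_rpow h0 ?_ hr.le
    gcongr
    linarith [abs_nonneg (prox q α z)]
  · simp_rw [hlim]
    exact (integrable_abs_rpow_gaussianReal hr).const_mul _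
  · refine Eventually.of_forall fun z => ?_
    have h := (((tendsto_abs_prox_atTop hq z).const_sub |z|).div_const q).rpow_const
      (p := 2 / (q - 1)) (Or.inr hr.le)
    rw [sub_zero] at h
    refine h.congr' ?_
    filter_upwards [eventually_gt_atTop 0] with α hα
    exact (rpow_mul_prox_sq hq hα z).symm
end

section
/- Let μ ≥ 0. Then for every α > 0, the function α ↦ ∫_ℝ (η₁(μ + z; α) − μ)² φ(z) dz is differentiable at α with derivative 2·[α·(Φ(μ − α) + Φ(−μ − α)) − φ(α − μ) − φ(α + μ)]. -/
open MeasureTheory ProbabilityTheory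

/-- The soft-thresholding operator `η₁(u; χ) = sgn(u)·max(|u| − χ, 0)`. -/
noncomputable def softThresh (u χ : ℝ) : ℝ :=
  Real.sign u * max (|u| - χ) 0

/-- The standard normal density `φ(s) = (2π)^{−1/2} e^{−s²/2}`. -/
noncomputable def stdGaussPDF (s : ℝ) : ℝ :=
  (Real.sqrt (2 * Real.pi))⁻¹ * Real.exp (-s ^ 2 / 2)

/-- The standard normal cumulative distribution function `Φ`. -/
noncomputable def stdGaussCDF (x : ℝ) : ℝ :=
  ∫ t in Set.Iic x, stdGaussPDF t

theorem softThresh_eq {a : ℝ} (ha : 0 ≤ a) (u : ℝ) :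
    softThresh u a = max (u - a) 0 - max (-u - a) 0 := by
  unfold softThresh
  rcases lt_trichotomy u 0 with h | h | h
  · rw [Real.sign_of_neg h, abs_of_neg h, max_eq_right (by linarith : u - a ≤ 0)]
    ring
  · simp [h]
  · rw [Real.sign_of_pos h, abs_of_pos h, max_eq_right (by linarith : -u - a ≤ 0)]
    ring

theorem abs_sign_le_one (u : ℝ) : |Real.sign u| ≤ 1 := by
  rcases Real.sign_apply_eq u with h | h | h <;> simp [h]

theorem abs_softThresh_sub_le (u a b : ℝ) : |softThresh u a - softThresh u b| ≤ |a - b| := by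
  unfold softThresh
  rw [← mul_sub, abs_mul]
  have h := abs_max_sub_max_le_abs (|u| - a) (|u| - b) 0
  rw [show |u| - a - (|u| - b) = b - a by ring, abs_sub_comm b a] at h
  calc _ ≤ 1 * |a - b| := mul_le_mul (abs_sign_le_one u) h (abs_nonneg _) zero_le_one
    _ = _ := one_mul _

theorem abs_softThresh_le {a : ℝ} (ha : 0 ≤ a) (u : ℝ) : |softThresh u a| ≤ |u| := by
  unfold softThresh
  rw [abs_mul, abs_of_nonneg (le_max_right (|u| - a) 0)]
  calc _ ≤ 1 * |u| := mul_le_mul (abs_sign_le_one u)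
        (max_le (by linarith) (abs_nonneg u)) (le_max_right _ _) zero_le_one
    _ = _ := one_mul _

theorem continuous_softThresh {a : ℝ} (ha : 0 ≤ a) : Continuous fun u => softThresh u a := by
  simp only [softThresh_eq ha]
  fun_prop

theorem hasDerivAt_stdGaussPDF (z : ℝ) : HasDerivAt stdGaussPDF (-(stdGaussPDF z * z)) z := by
  unfold stdGaussPDF
  have h : HasDerivAt (fun s : ℝ => -s ^ 2 / 2) (-z) z :=
    ((hasDerivAt_pow 2 z).fun_neg.div_const 2).congr_deriv (by simp; ring)
  exact (h.exp.const_mul (Real.sqrt (2 * Real.pi))⁻¹).congr_deriv (by ring)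

theorem stdGaussPDF_neg (z : ℝ) : stdGaussPDF (-z) = stdGaussPDF z := by
  simp [stdGaussPDF]

theorem integrable_stdGaussPDF : Integrable stdGaussPDF := by
  have h := (integrable_exp_neg_mul_sq (b := 1 / 2) (by norm_num)).const_mul
    (Real.sqrt (2 * Real.pi))⁻¹
  refine h.congr (.of_forall fun z => ?_)
  simp only [stdGaussPDF]
  ring_nf

theorem integrable_stdGaussPDF_mul : Integrable fun z => stdGaussPDF z * z := by
  have h := (integrable_mul_exp_neg_mul_sq (b := 1 / 2) (by norm_num)).const_mul
    (Real.sqrt (2 * Real.pi))⁻¹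
  refine h.congr (.of_forall fun z => ?_)
  simp only [stdGaussPDF]
  ring_nf

theorem integral_Ioi_stdGaussPDF (c : ℝ) : ∫ z in Set.Ioi c, stdGaussPDF z = stdGaussCDF (-c) := by
  have h := integral_comp_neg_Iic (-c) stdGaussPDF
  simp only [stdGaussPDF_neg, neg_neg] at h
  exact h.symm

theorem integral_Ioi_stdGaussPDF_mul (c : ℝ) :
    ∫ z in Set.Ioi c, stdGaussPDF z * z = stdGaussPDF c := by
  have hi := integrable_stdGaussPDF_mul.neg.integrableOn (s := Set.Ioi c)
  have h := integral_Ioi_of_hasDerivAt_of_tendsto' (a := c)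
    (fun x _ => hasDerivAt_stdGaussPDF x) hi
    (tendsto_zero_of_hasDerivAt_of_integrableOn_Ioi (fun x _ => hasDerivAt_stdGaussPDF x) hi
      integrable_stdGaussPDF.integrableOn)
  rw [integral_neg] at h
  linarith

theorem integral_Iic_stdGaussPDF_mul (c : ℝ) :
    ∫ z in Set.Iic c, stdGaussPDF z * z = -stdGaussPDF c := by
  have hi := integrable_stdGaussPDF_mul.neg.integrableOn (s := Set.Iic c)
  have h := integral_Iic_of_hasDerivAt_of_tendsto' (a := c)
    (fun x _ => hasDerivAt_stdGaussPDF x) hi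
    (tendsto_zero_of_hasDerivAt_of_integrableOn_Iic (fun x _ => hasDerivAt_stdGaussPDF x) hi
      integrable_stdGaussPDF.integrableOn)
  rw [integral_neg] at h
  linarith

theorem gaussianPDFReal_zero_one (z : ℝ) : gaussianPDFReal 0 1 z = stdGaussPDF z := by
  simp [gaussianPDFReal, stdGaussPDF]

/-- The derivative in `α` of `(η₁(μ + z; α) − μ)²`, for `|μ + z| ≠ α`. -/
noncomputable def softThreshLossDeriv (μ α z : ℝ) : ℝ :=
  (Set.Ioi (α - μ)).indicator (fun z => -2 * (z - α)) z
    + (Set.Iic (-μ - α)).indicator (fun z => 2 * (z + α)) z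

theorem measurable_softThreshLossDeriv (μ α : ℝ) : Measurable (softThreshLossDeriv μ α) := by
  unfold softThreshLossDeriv
  exact (Measurable.indicator (by fun_prop) measurableSet_Ioi).add
    (Measurable.indicator (by fun_prop) measurableSet_Iic)

theorem integral_softThreshLossDeriv (μ α : ℝ) :
    ∫ z, softThreshLossDeriv μ α z ∂(gaussianReal 0 1) =
      2 * (α * (stdGaussCDF (μ - α) + stdGaussCDF (-μ - α))
        - stdGaussPDF (α - μ) - stdGaussPDF (α + μ)) := by
  rw [integral_gaussianReal_eq_integral_smul one_ne_zero]
  have e : ∀ z, gaussianPDFReal 0 1 z • softThreshLossDeriv μ α z =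
      (Set.Ioi (α - μ)).indicator
          (fun z => -2 * (stdGaussPDF z * z) + 2 * α * stdGaussPDF z) z
        + (Set.Iic (-μ - α)).indicator
          (fun z => 2 * (stdGaussPDF z * z) + 2 * α * stdGaussPDF z) z := by
    intro z
    simp only [gaussianPDFReal_zero_one, softThreshLossDeriv, Set.indicator_apply, smul_eq_mul]
    split_ifs <;> ring
  have i1 := integrable_stdGaussPDF_mul.const_mul (-2)
  have i2 := integrable_stdGaussPDF_mul.const_mul 2
  have i3 := integrable_stdGaussPDF.const_mul (2 * α)
  simp only [e]
  have i4 := (i1.fun_add i3).indicator (measurableSet_Ioi (a := α - μ))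
  have i5 := (i2.fun_add i3).indicator (measurableSet_Iic (a := -μ - α))
  rw [integral_add i4 i5,
    integral_indicator measurableSet_Ioi, integral_indicator measurableSet_Iic,
    integral_add i1.integrableOn i3.integrableOn, integral_add i2.integrableOn i3.integrableOn]
  simp only [integral_const_mul]
  rw [integral_Ioi_stdGaussPDF_mul, integral_Iic_stdGaussPDF_mul, integral_Ioi_stdGaussPDF,
    ← stdGaussPDF_neg (-μ - α), show -(α - μ) = μ - α by ring,
    show -(-μ - α) = α + μ by ring, ← stdGaussCDF]
  ring

theorem hasDerivAt_softThresh_loss {μ α z : ℝ} (hα : 0 < α) (h1 : z ≠ α - μ) (h2 : z ≠ -μ - α) :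
    HasDerivAt (fun a => (softThresh (μ + z) a - μ) ^ 2) (softThreshLossDeriv μ α z) α := by
  have hpos := lt_mem_nhds hα
  unfold softThreshLossDeriv
  rcases lt_or_gt_of_ne h1 with h1 | h1
  · rw [Set.indicator_of_notMem (by simpa using h1.le), zero_add]
    rcases lt_or_gt_of_ne h2 with h2 | h2
    · rw [Set.indicator_of_mem (by simpa using h2.le)]
      have hd : HasDerivAt (fun a : ℝ => (z + a) ^ 2) (2 * (z + α)) α := by
        simpa using ((hasDerivAt_id' α).const_add z).fun_pow 2
      refine hd.congr_of_eventuallyEq ?_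
      filter_upwards [hpos, gt_mem_nhds (show α < -μ - z by linarith)] with a ha ha'
      rw [softThresh_eq ha.le, max_eq_right (by linarith), max_eq_left (by linarith)]
      ring
    · rw [Set.indicator_of_notMem (by simpa using h2)]
      refine (hasDerivAt_const α (μ ^ 2)).congr_of_eventuallyEq ?_
      filter_upwards [hpos, lt_mem_nhds (show μ + z < α by linarith),
        lt_mem_nhds (show -μ - z < α by linarith)] with a ha ha' ha''
      rw [softThresh_eq ha.le, max_eq_right (by linarith), max_eq_right (by linarith)]
      ring
  · rw [Set.indicator_of_mem (by simpa using h1),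
      Set.indicator_of_notMem (by simp only [Set.mem_Iic]; linarith), add_zero]
    have hd : HasDerivAt (fun a : ℝ => (z - a) ^ 2) (-2 * (z - α)) α :=
      (((hasDerivAt_id' α).const_sub z).fun_pow 2).congr_deriv (by simp)
    refine hd.congr_of_eventuallyEq ?_
    filter_upwards [hpos, gt_mem_nhds (show α < μ + z by linarith)] with a ha ha'
    rw [softThresh_eq ha.le, max_eq_left (by linarith), max_eq_right (by linarith)]
    ring

theorem lipschitzOnWith_softThresh_loss (μ z : ℝ) :
    LipschitzOnWith (Real.nnabs (2 * (|μ + z| + |μ|)))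
      (fun a => (softThresh (μ + z) a - μ) ^ 2) (Set.Ioi 0) := by
  refine LipschitzOnWith.of_dist_le_mul fun a ha b hb => ?_
  have hz : 0 ≤ 2 * (|μ + z| + |μ|) := by positivity
  rw [Real.dist_eq, Real.dist_eq, Real.coe_nnabs, abs_of_nonneg hz,
    show (softThresh (μ + z) a - μ) ^ 2 - (softThresh (μ + z) b - μ) ^ 2 =
      ((softThresh (μ + z) a - μ) + (softThresh (μ + z) b - μ)) *
        (softThresh (μ + z) a - softThresh (μ + z) b) by ring, abs_mul]
  refine mul_le_mul ?_ (abs_softThresh_sub_le _ _ _) (abs_nonneg _) hz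
  have h1 := abs_softThresh_le (le_of_lt ha) (μ + z)
  have h2 := abs_softThresh_le (le_of_lt hb) (μ + z)
  have h3 := abs_add_le (softThresh (μ + z) a - μ) (softThresh (μ + z) b - μ)
  have h4 := abs_sub (softThresh (μ + z) a) μ
  have h5 := abs_sub (softThresh (μ + z) b) μ
  linarith

theorem memLp_softThresh_gaussianReal (μ : ℝ) {a : ℝ} (ha : 0 ≤ a) :
    MemLp (fun z => softThresh (μ + z) a - μ) 2 (gaussianReal 0 1) := by
  have hid : MemLp (fun z : ℝ => μ + z) 2 (gaussianReal 0 1) :=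
    (memLp_const μ).add (memLp_id_gaussianReal 2)
  have hc := continuous_softThresh ha
  refine (hid.mono (Continuous.aestronglyMeasurable (by fun_prop)) (.of_forall fun z => ?_)).sub
    (memLp_const μ)
  exact abs_softThresh_le ha _

/-- For `μ ≥ 0` and `α > 0`, the function
`α ↦ E(η₁(μ + Z; α) − μ)²` is differentiable at `α` with derivative
`2·[α·(Φ(μ−α) + Φ(−μ−α)) − φ(α−μ) − φ(α+μ)]`, `Z` standard Gaussian. -/
theorem stmt_12 (μ : ℝ) (hμ : 0 ≤ μ) (α : ℝ) (hα : 0 < α) :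
    HasDerivAt (fun a : ℝ => ∫ z, (softThresh (μ + z) a - μ) ^ 2 ∂(gaussianReal 0 1))
      (2 * (α * (stdGaussCDF (μ - α) + stdGaussCDF (-μ - α))
        - stdGaussPDF (α - μ) - stdGaussPDF (α + μ))) α := by
  have hint : Integrable (fun z : ℝ => 2 * (|μ + z| + |μ|)) (gaussianReal 0 1) := by
    have hid : Integrable (fun z : ℝ => z) (gaussianReal 0 1) :=
      memLp_one_iff_integrable.mp (memLp_id_gaussianReal 1)
    exact ((((integrable_const μ).add hid).abs).add (integrable_const _)).const_mul 2
  have : NullSingletonClass (gaussianReal 0 1) := nullSingletonClass_gaussianReal one_ne_zero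
  rw [← integral_softThreshLossDeriv]
  refine (hasDerivAt_integral_of_dominated_loc_of_lip (Ioi_mem_nhds hα) ?_
    (memLp_softThresh_gaussianReal μ hα.le).integrable_sq
    (measurable_softThreshLossDeriv μ α).aestronglyMeasurable
    (.of_forall (lipschitzOnWith_softThresh_loss μ)) hint ?_).2
  · filter_upwards [lt_mem_nhds hα] with a ha
    exact (memLp_softThresh_gaussianReal μ (le_of_lt ha)).integrable_sq.aestronglyMeasurable
  · filter_upwards [Measure.ae_ne (gaussianReal 0 1) (α - μ),
      Measure.ae_ne (gaussianReal 0 1) (-μ - α)] with z h1 h2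
    exact hasDerivAt_softThresh_loss hα h1 h2
end
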